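/- Let q ≥ 1, α ∈ ℝ, n ∈ ℕ₀, and (s_j)_{j=0}^{2n+1} ∈ K≥,e_{α,q,2n+1}; write T := T_{q,n}, v := v_{q,n}, I := I_{(n+1)q}. Define Ũ_{n,α} : ℂ → ℂ^{2q×2q} by Ũ_{n,α}(ζ) := I_{2q} + (ζ−α)·(I₂⊗v)*·[(R_T(α))^{−1}·H_n, −I]*·R_{T*}(ζ)·H_{α▷n}^⊐·R_T(α)·[I, (R_T(α))^{−1}·H_n]·(I₂⊗v). Then for all z, w ∈ ℂ: J̃_q − Ũ_{n,α}(z)·J̃_q·Ũ_{n,α}(w)* = −i·(z − conj(w))·(I₂⊗v)*·[(R_T(α))^{−1}·H_n, −I]*·R_{T*}(z)·H_{α▷n}^⊐·(R_{T*}(w))*·[(R_T(α))^{−1}·H_n, −I]·(I₂⊗v). -/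

import Mathlib

open Matrix ComplexConjugate
open scoped ComplexOrder

noncomputable section

/-- The block Hankel matrix `H_n = [s_{j+k}]_{j,k=0}^n`. -/
def hank (q n : ℕ) (s : ℕ → Matrix (Fin q) (Fin q) ℂ) :
    Matrix (Fin (n + 1) × Fin q) (Fin (n + 1) × Fin q) ℂ :=
  Matrix.of fun j k => s (j.1.val + k.1.val) j.2 k.2

/-- The right-sided `α`-shifted sequence `s_{α▷j} = -α·s_j + s_{j+1}`. -/
def sShift {q : ℕ} (α : ℝ) (s : ℕ → Matrix (Fin q) (Fin q) ℂ) :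
    ℕ → Matrix (Fin q) (Fin q) ℂ :=
  fun j => (-(α : ℂ)) • s j + s (j + 1)

/-- The block shift `T_{q,n} = [δ_{j,k+1}·I_q]_{j,k=0}^n`. -/
def bshift (q n : ℕ) : Matrix (Fin (n + 1) × Fin q) (Fin (n + 1) × Fin q) ℂ :=
  Matrix.of fun j k => if j.1.val = k.1.val + 1 ∧ j.2 = k.2 then (1 : ℂ) else 0

/-- `v_{q,n} = col(δ_{j,0}·I_q)_{j=0}^n`. -/
def vq (q n : ℕ) : Matrix (Fin (n + 1) × Fin q) (Fin q) ℂ :=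
  Matrix.of fun j b => if j.1.val = 0 ∧ j.2 = b then (1 : ℂ) else 0

/-- `u_n = -col(s_{j-1})_{j=0}^n` with `s_{-1} = 0`. -/
def uq (q n : ℕ) (s : ℕ → Matrix (Fin q) (Fin q) ℂ) :
    Matrix (Fin (n + 1) × Fin q) (Fin q) ℂ :=
  Matrix.of fun j b => if j.1.val = 0 then 0 else -s (j.1.val - 1) j.2 b

/-- `y_{0,n} = col(s_j)_{j=0}^n`. -/
def yq (q n : ℕ) (s : ℕ → Matrix (Fin q) (Fin q) ℂ) :
    Matrix (Fin (n + 1) × Fin q) (Fin q) ℂ :=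
  Matrix.of fun j b => s j.1.val j.2 b

/-- `R_T(z) = (I - z·T_{q,n})⁻¹`. -/
def RT (q n : ℕ) (z : ℂ) : Matrix (Fin (n + 1) × Fin q) (Fin (n + 1) × Fin q) ℂ :=
  (1 - z • bshift q n)⁻¹

/-- `R_{T*}(z) = (I - z·T_{q,n}*)⁻¹`. -/
def RTs (q n : ℕ) (z : ℂ) : Matrix (Fin (n + 1) × Fin q) (Fin (n + 1) × Fin q) ℂ :=
  (1 - z • (bshift q n)ᴴ)⁻¹

open scoped Classical in
/-- The Moore–Penrose inverse of a complex matrix (it exists and is unique,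
so the `dite` below always takes its first branch and picks it out). -/
def mp {m n : Type*} [Fintype m] [Fintype n] (A : Matrix m n ℂ) : Matrix n m ℂ :=
  if h : ∃ X : Matrix n m ℂ,
      A * X * A = A ∧ X * A * X = X ∧ (A * X)ᴴ = A * X ∧ (X * A)ᴴ = X * A
  then h.choose else 0

/-- The Schur complements `L_0 = s_0` and
`L_j = s_{2j} - z_{j,2j-1}·(H_{j-1})^†·y_{j,2j-1}` for `j ≥ 1`. -/
def LS (q : ℕ) (s : ℕ → Matrix (Fin q) (Fin q) ℂ) : ℕ → Matrix (Fin q) (Fin q) ℂ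
  | 0 => s 0
  | n + 1 =>
      s (2 * (n + 1)) -
        (Matrix.of fun (a : Fin q) (j : Fin (n + 1) × Fin q) => s ((n + 1) + j.1.val) a j.2) *
          mp (hank q n s) *
          (Matrix.of fun (j : Fin (n + 1) × Fin q) (b : Fin q) => s ((n + 1) + j.1.val) j.2 b)

/-- The block diagonal matrix `diag(L_0, …, L_n)`. -/
def Ldiag (q n : ℕ) (s : ℕ → Matrix (Fin q) (Fin q) ℂ) :
    Matrix (Fin (n + 1) × Fin q) (Fin (n + 1) × Fin q) ℂ :=
  Matrix.of fun j k => if j.1 = k.1 then LS q s j.1.val j.2 k.2 else 0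

/-- The subspace `D_n = range(diag(L_0, …, L_n)) ⊆ ℂ^{(n+1)q}`. -/
def Dsub (q n : ℕ) (s : ℕ → Matrix (Fin q) (Fin q) ℂ) :
    Submodule ℂ (Fin (n + 1) × Fin q → ℂ) :=
  LinearMap.range (Matrix.mulVecLin (Ldiag q n s))

/-- `V_{q,n+1} = [δ_{j,k}·I_q]`, embedding `ℂ^{(n+1)q}` into the first `n+1` block
components of `ℂ^{(n+2)q}` (defined here with `n+1` block columns). -/
def embV (q n : ℕ) : Matrix (Fin (n + 1) × Fin q) (Fin n × Fin q) ℂ :=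
  Matrix.of fun j k => if j.1.val = k.1.val ∧ j.2 = k.2 then (1 : ℂ) else 0

/-- `𝔙_{q,n+1} = [δ_{j,k+1}·I_q]`, embedding `ℂ^{(n+1)q}` into the last `n+1` block
components of `ℂ^{(n+2)q}` (defined here with `n+1` block columns). -/
def embW (q n : ℕ) : Matrix (Fin (n + 1) × Fin q) (Fin n × Fin q) ℂ :=
  Matrix.of fun j k => if j.1.val = k.1.val + 1 ∧ j.2 = k.2 then (1 : ℂ) else 0

end

/-- `G` is the generalized inverse `H_D^⊐` of a Hermitian matrix `H` associated with a
subspace `D`: `HGH = H`, `GHG = G`, `range G = D` and `ker G = D^⊥`. -/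
def IsRGI {ι : Type*} [Fintype ι] (H G : Matrix ι ι ℂ) (D : Submodule ℂ (ι → ℂ)) : Prop :=
  H * G * H = H ∧ G * H * G = G ∧
    LinearMap.range (Matrix.mulVecLin G) = D ∧
    ∀ x : ι → ℂ, Matrix.mulVec G x = 0 ↔ ∀ y ∈ D, dotProduct (star y) x = 0

noncomputable section

/-- The signature matrix `J̃_q = [[0, -i·I_q], [i·I_q, 0]]`. -/
def Jmat (q : ℕ) : Matrix (Fin q ⊕ Fin q) (Fin q ⊕ Fin q) ℂ :=
  Matrix.fromBlocks 0 ((-Complex.I) • (1 : Matrix (Fin q) (Fin q) ℂ))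
    (Complex.I • (1 : Matrix (Fin q) (Fin q) ℂ)) 0

/-- `I₂ ⊗ v_{q,n} = diag(v_{q,n}, v_{q,n})`. -/
def kvq (q n : ℕ) :
    Matrix ((Fin (n + 1) × Fin q) ⊕ (Fin (n + 1) × Fin q)) (Fin q ⊕ Fin q) ℂ :=
  Matrix.fromBlocks (vq q n) 0 0 (vq q n)

end

noncomputable section

/-- The matrix polynomial `Ũ_{n,α}(ζ)` built from `H_{α▷n}^⊐ = Gα`. -/
def Utilde (q n : ℕ) (α : ℝ) (s : ℕ → Matrix (Fin q) (Fin q) ℂ)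
    (Gα : Matrix (Fin (n + 1) × Fin q) (Fin (n + 1) × Fin q) ℂ) (ζ : ℂ) :
    Matrix (Fin q ⊕ Fin q) (Fin q ⊕ Fin q) ℂ :=
  1 + (ζ - (α : ℂ)) •
    ((kvq q n)ᴴ *
      (Matrix.fromCols ((RT q n (α : ℂ))⁻¹ * hank q n s)
        (-1 : Matrix (Fin (n + 1) × Fin q) (Fin (n + 1) × Fin q) ℂ))ᴴ * RTs q n ζ * Gα *
      RT q n (α : ℂ) *
      Matrix.fromCols (1 : Matrix (Fin (n + 1) × Fin q) (Fin (n + 1) × Fin q) ℂ)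
        ((RT q n (α : ℂ))⁻¹ * hank q n s) * kvq q n)

end

abbrev NI (q n : ℕ) := Fin (n + 1) × Fin q

theorem bshift_mulVec_zero (q n : ℕ) (x : NI q n → ℂ) (a : Fin q) :
    (bshift q n *ᵥ x) (0, a) = 0 := by
  simp [bshift, Matrix.mulVec, dotProduct]

theorem bshift_mulVec_succ (q n : ℕ) (x : NI q n → ℂ) (i : Fin n) (a : Fin q) :
    (bshift q n *ᵥ x) (i.succ, a) = x (i.castSucc, a) := by
  simp only [bshift, Matrix.mulVec, dotProduct, Matrix.of_apply]
  rw [Finset.sum_eq_single (i.castSucc, a)]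
  · simp
  · rintro ⟨k, b⟩ _ h
    rw [if_neg, zero_mul]
    rintro ⟨h1, h2⟩
    apply h
    ext1
    · ext; simp at h1 ⊢; omega
    · exact h2.symm
  · simp

theorem bshift_pow_mulVec (q n k : ℕ) (x : NI q n → ℂ) (j : NI q n) (hj : j.1.val < k) :
    (bshift q n ^ k *ᵥ x) j = 0 := by
  induction k generalizing j with
  | zero => simp at hj
  | succ k ih =>
    rw [pow_succ', ← Matrix.mulVec_mulVec]
    obtain ⟨j, a⟩ := j
    refine Fin.cases ?_ (fun i hj => ?_) j hj
    · intro _; exact bshift_mulVec_zero _ _ _ _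
    · rw [bshift_mulVec_succ]; apply ih; simp at hj ⊢; exact hj

theorem bshift_pow (q n : ℕ) : bshift q n ^ (n + 1) = 0 := by
  apply Matrix.ext_of_mulVec_single
  intro j
  ext i
  rw [bshift_pow_mulVec _ _ _ _ _ i.1.isLt]; simp

theorem one_sub_mul_geom (q n : ℕ) (z : ℂ) :
    (1 - z • bshift q n) * (∑ i ∈ Finset.range (n + 1), (z • bshift q n) ^ i) = 1 := by
  rw [mul_neg_geom_sum, smul_pow, bshift_pow]; simp

theorem RT_eq (q n : ℕ) (z : ℂ) :
    RT q n z = ∑ i ∈ Finset.range (n + 1), (z • bshift q n) ^ i :=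
  Matrix.inv_eq_right_inv (one_sub_mul_geom q n z)

theorem RT_right (q n : ℕ) (z : ℂ) : (1 - z • bshift q n) * RT q n z = 1 := by
  rw [RT_eq, one_sub_mul_geom]

theorem RT_left (q n : ℕ) (z : ℂ) : RT q n z * (1 - z • bshift q n) = 1 :=
  mul_eq_one_comm.mp (RT_right q n z)

theorem RT_inv (q n : ℕ) (z : ℂ) : (RT q n z)⁻¹ = 1 - z • bshift q n :=
  Matrix.inv_eq_right_inv (RT_left q n z)

theorem RTs_eq (q n : ℕ) (z : ℂ) : RTs q n z = (RT q n (conj z))ᴴ := by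
  apply Matrix.inv_eq_right_inv
  have := congrArg conjTranspose (RT_left q n (conj z))
  simpa [Matrix.conjTranspose_mul] using this

/-- resolvent identity -/
theorem RT_resolvent (q n : ℕ) (a z : ℂ) :
    (z - a) • (RT q n a * bshift q n * RT q n z) = RT q n z - RT q n a := by
  have h : (z - a) • bshift q n = (1 - a • bshift q n) - (1 - z • bshift q n) := by
    rw [sub_smul]; abel
  calc (z - a) • (RT q n a * bshift q n * RT q n z)
      = RT q n a * ((z - a) • bshift q n) * RT q n z := by simp
    _ = (RT q n a * (1 - a • bshift q n)) * RT q n z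
        - RT q n a * ((1 - z • bshift q n) * RT q n z) := by
          rw [h, mul_sub, sub_mul, mul_assoc _ (1 - z • bshift q n)]
    _ = _ := by rw [RT_left, RT_right, one_mul, mul_one]

theorem shift_identity (q n : ℕ) (α : ℝ) (s : ℕ → Matrix (Fin q) (Fin q) ℂ) :
    bshift q n * hank q n (sShift α s) =
      (1 - (α : ℂ) • bshift q n) * hank q n s - vq q n * (vq q n)ᴴ * hank q n s := by
  have e : ∀ (M : Matrix (NI q n) (NI q n) ℂ) i j,
      (bshift q n * M) i j = (bshift q n *ᵥ (fun k => M k j)) i := fun M i j => rfl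
  have hv : ∀ (M : Matrix (NI q n) (NI q n) ℂ) (i : Fin (n+1)) a j,
      (vq q n * (vq q n)ᴴ * M) (i, a) j = if i.val = 0 then M (0, a) j else 0 := by
    intro M i a j
    rw [Matrix.mul_assoc, Matrix.mul_apply]
    have : ∀ b, ((vq q n)ᴴ * M) b j = M (0, b) j := by
      intro b
      rw [Matrix.mul_apply, Finset.sum_eq_single (0, b)]
      · simp [vq]
      · rintro ⟨k, c⟩ _ h
        simp only [vq, conjTranspose_apply, of_apply]
        rw [if_neg]; · simp
        rintro ⟨h1, h2⟩
        exact h (Prod.ext (Fin.ext h1) h2)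
      · simp
    simp only [this]
    simp only [vq, of_apply]
    by_cases hi : i.val = 0 <;> simp [hi]
  ext ⟨i, a⟩ j
  rw [sub_mul, one_mul, Matrix.sub_apply, Matrix.sub_apply, hv, smul_mul_assoc, Matrix.smul_apply, e, e]
  refine Fin.cases ?_ (fun i => ?_) i
  · rw [bshift_mulVec_zero, bshift_mulVec_zero]; simp
  · rw [bshift_mulVec_succ, bshift_mulVec_succ]
    simp only [hank, of_apply, sShift, Matrix.add_apply, Matrix.smul_apply, Fin.val_succ, Fin.val_castSucc]
    rw [show i.val + j.1.val + 1 = i.val + 1 + j.1.val by ring]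
    simp; ring

theorem RGI_herm {ι : Type*} [Fintype ι] [DecidableEq ι] (H G : Matrix ι ι ℂ) (D : Submodule ℂ (ι → ℂ))
    (h : IsRGI H G D) (hH : Hᴴ = H) : Gᴴ = G := by
  obtain ⟨h1, h2, h3, h4⟩ := h
  have key : ∀ x, Gᴴ *ᵥ x = 0 → G *ᵥ x = 0 := by
    intro x hx
    rw [h4]
    intro y hy
    rw [← h3] at hy
    obtain ⟨u, rfl⟩ := hy
    rw [Matrix.mulVecLin_apply, Matrix.star_mulVec, ← Matrix.dotProduct_mulVec, hx]
    simp
  have h5 : Gᴴ * (1 - H * Gᴴ) = 0 := by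
    have := congrArg conjTranspose h2
    rw [Matrix.conjTranspose_mul, Matrix.conjTranspose_mul, hH] at this
    rw [mul_sub, mul_one, this, sub_self]
  have h6 : G * (1 - H * Gᴴ) = 0 := by
    apply Matrix.ext_of_mulVec_single
    intro j
    rw [← Matrix.mulVec_mulVec, key]
    · rw [Matrix.zero_mulVec]
    · rw [Matrix.mulVec_mulVec, h5, Matrix.zero_mulVec]
  rw [mul_sub, mul_one, sub_eq_zero, ← mul_assoc] at h6
  have h7 := congrArg conjTranspose h6
  rw [Matrix.conjTranspose_mul, Matrix.conjTranspose_mul, hH, Matrix.conjTranspose_conjTranspose, ← mul_assoc] at h7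
  rw [h7, ← h6]

theorem RGI_ker {ι : Type*} [Fintype ι] [DecidableEq ι] (H G L : Matrix ι ι ℂ)
    (h : IsRGI H G (LinearMap.range (Matrix.mulVecLin L))) (hL : Lᴴ = L) (x : ι → ℂ) :
    G *ᵥ x = 0 ↔ L *ᵥ x = 0 := by
  obtain ⟨h1, h2, h3, h4⟩ := h
  rw [h4]
  constructor
  · intro hx
    have := hx (L *ᵥ (L *ᵥ x)) ⟨_, rfl⟩
    rw [Matrix.star_mulVec, ← Matrix.dotProduct_mulVec, hL] at this
    exact dotProduct_star_self_eq_zero.mp this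
  · rintro hx y ⟨u, rfl⟩
    rw [Matrix.mulVecLin_apply, Matrix.star_mulVec, ← Matrix.dotProduct_mulVec, hL, hx]
    simp

theorem G_RT (q n : ℕ) (a : ℂ) (H G : Matrix (NI q n) (NI q n) ℂ) (h2 : G * H * G = G)
    (hker : ∀ x, G *ᵥ x = 0 → G *ᵥ (bshift q n *ᵥ x) = 0) :
    G * RT q n a * bshift q n * H * G = G * RT q n a * bshift q n := by
  have hpow : ∀ k x, G *ᵥ x = 0 → G *ᵥ (bshift q n ^ k *ᵥ x) = 0 := by
    intro k
    induction k with
    | zero => simp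
    | succ k ih =>
      intro x hx
      rw [pow_succ', ← Matrix.mulVec_mulVec]
      exact hker _ (ih x hx)
  have h3 : ∀ k, G * bshift q n ^ k * (1 - H * G) = 0 := by
    intro k
    apply Matrix.ext_of_mulVec_single
    intro j
    rw [← Matrix.mulVec_mulVec, ← Matrix.mulVec_mulVec, hpow]
    · rw [Matrix.zero_mulVec]
    · rw [Matrix.mulVec_mulVec, mul_sub, mul_one, ← mul_assoc, h2, sub_self, Matrix.zero_mulVec]
  have h4 : G * RT q n a * bshift q n * (1 - H * G) = 0 := by
    rw [RT_eq, Finset.mul_sum, Finset.sum_mul, Finset.sum_mul]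
    apply Finset.sum_eq_zero
    intro k _
    rw [smul_pow, Matrix.mul_smul, Matrix.smul_mul, Matrix.smul_mul, mul_assoc G, ← pow_succ, h3, smul_zero]
  rw [mul_sub, mul_one, sub_eq_zero] at h4
  rw [mul_assoc _ H G, ← h4]

theorem abs_alg {ι m : Type*} [Fintype ι] [DecidableEq ι] [Fintype m] [DecidableEq m]
    (B C : Matrix ι m ℂ) (J : Matrix m m ℂ) (P R Q T G H : Matrix ι ι ℂ) (a b : ℂ)
    (hJ : Jᴴ = J) (hCJ : C * J = Complex.I • (R * B))
    (hCJC : C * J * Cᴴ = (-Complex.I) • (H * Tᴴ * Rᴴ - R * T * H))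
    (hH : Hᴴ = H) (hG : Gᴴ = G) (hR : G * R * T * H * G = G * R * T)
    (hQ : b • (R * T * Q) = Q - R) (hP : a • (P * Tᴴ * Rᴴ) = P - Rᴴ) :
    J - (1 + a • (Bᴴ * P * G * C)) * J * (1 + b • (Cᴴ * G * Q * B)) =
      (-Complex.I * (a - b)) • (Bᴴ * P * G * Q * B) := by
  have hJC : J * Cᴴ = (-Complex.I) • (Bᴴ * Rᴴ) := by
    have := congrArg conjTranspose hCJ
    simpa [Matrix.conjTranspose_mul, hJ] using this
  have hR' : G * H * Tᴴ * Rᴴ * G = Tᴴ * Rᴴ * G := by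
    have := congrArg conjTranspose hR
    simpa [Matrix.conjTranspose_mul, hG, hH, Matrix.mul_assoc] using this
  have e1 : Bᴴ * P * G * C * J = Complex.I • (Bᴴ * P * G * R * B) := by
    rw [Matrix.mul_assoc _ C J, hCJ]; simp [Matrix.mul_assoc]
  have e2 : J * (Cᴴ * G * Q * B) = (-Complex.I) • (Bᴴ * Rᴴ * G * Q * B) := by
    rw [← Matrix.mul_assoc, ← Matrix.mul_assoc, ← Matrix.mul_assoc, hJC]; simp [Matrix.mul_assoc]
  have e3 : Bᴴ * P * G * C * J * (Cᴴ * G * Q * B) =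
      (-Complex.I) • (Bᴴ * (P * Tᴴ * Rᴴ) * G * Q * B - Bᴴ * P * G * (R * T * Q) * B) := by
    calc _ = Bᴴ * P * G * (C * J * Cᴴ) * G * Q * B := by simp only [Matrix.mul_assoc]
      _ = (-Complex.I) • (Bᴴ * P * (G * H * Tᴴ * Rᴴ * G) * Q * B - Bᴴ * P * (G * R * T * H * G) * Q * B) := by
        rw [hCJC]
        simp only [Matrix.mul_smul, Matrix.smul_mul, Matrix.mul_sub, Matrix.sub_mul, Matrix.mul_assoc]
      _ = _ := by rw [hR, hR']; simp only [Matrix.mul_assoc]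
  have e4 : a • (Bᴴ * (P * Tᴴ * Rᴴ) * G * Q * B) = Bᴴ * P * G * Q * B - Bᴴ * Rᴴ * G * Q * B := by
    calc _ = Bᴴ * (a • (P * Tᴴ * Rᴴ)) * G * Q * B := by simp only [Matrix.mul_smul, Matrix.smul_mul]
      _ = _ := by rw [hP]; simp only [Matrix.mul_sub, Matrix.sub_mul]
  have e5 : b • (Bᴴ * P * G * (R * T * Q) * B) = Bᴴ * P * G * Q * B - Bᴴ * P * G * R * B := by
    calc _ = Bᴴ * P * G * (b • (R * T * Q)) * B := by simp only [Matrix.mul_smul, Matrix.smul_mul]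
      _ = _ := by rw [hQ]; simp only [Matrix.mul_sub, Matrix.sub_mul]
  have e6 : J - (1 + a • (Bᴴ * P * G * C)) * J * (1 + b • (Cᴴ * G * Q * B)) =
      -(a • (Bᴴ * P * G * C * J)) - b • (J * (Cᴴ * G * Q * B))
        - (a * b) • (Bᴴ * P * G * C * J * (Cᴴ * G * Q * B)) := by
    rw [Matrix.add_mul, Matrix.one_mul, Matrix.mul_add, Matrix.mul_one, Matrix.add_mul]
    simp only [Matrix.mul_smul, Matrix.smul_mul, smul_smul]
    rw [mul_comm b a]
    abel
  rw [e6, e3, e1, e2]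
  have e7 : ∀ X Y : Matrix m m ℂ, (a * b) • (-Complex.I) • (X - Y) =
     (-Complex.I) • (b • a • X - a • b • Y) := by
    intro X Y; module
  rw [e7, e4, e5]
  module

theorem main_alg (q n : ℕ) (α : ℝ) (s : ℕ → Matrix (Fin q) (Fin q) ℂ)
    (G : Matrix (NI q n) (NI q n) ℂ)
    (hH : (hank q n s)ᴴ = hank q n s)
    (hHa : (hank q n (sShift α s))ᴴ = hank q n (sShift α s))
    (hG : Gᴴ = G)
    (hR : G * RT q n α * bshift q n * hank q n (sShift α s) * G = G * RT q n α * bshift q n)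
    (z w : ℂ) :
      Jmat q - Utilde q n α s G z * Jmat q * (Utilde q n α s G w)ᴴ =
        ((-Complex.I) * (z - conj w)) •
          ((kvq q n)ᴴ *
            (Matrix.fromCols ((RT q n (α : ℂ))⁻¹ * hank q n s)
              (-1 : Matrix (Fin (n + 1) × Fin q) (Fin (n + 1) × Fin q) ℂ))ᴴ * RTs q n z *
            G * (RTs q n w)ᴴ *
            Matrix.fromCols ((RT q n (α : ℂ))⁻¹ * hank q n s)
              (-1 : Matrix (Fin (n + 1) × Fin q) (Fin (n + 1) × Fin q) ℂ) *
            kvq q n) := by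
  have hsh := shift_identity q n α s
  have hres1 := RT_resolvent q n α (conj w)
  have hres2 := congrArg conjTranspose (RT_resolvent q n α (conj z))
  have hRT := RT_left q n (α : ℂ)
  have hCm : RT q n (α : ℂ) * fromCols (1 : Matrix (NI q n) (NI q n) ℂ) ((RT q n (α : ℂ))⁻¹ * hank q n s) * kvq q n
      = fromCols (RT q n α * vq q n) (hank q n s * vq q n) := by
    rw [RT_inv, Matrix.mul_assoc, kvq, fromCols_mul_fromBlocks, mul_fromCols]
    simp only [Matrix.mul_zero, add_zero, zero_add, Matrix.one_mul]
    rw [← Matrix.mul_assoc, ← Matrix.mul_assoc, hRT, Matrix.one_mul]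
  have hBm : fromCols ((RT q n (α : ℂ))⁻¹ * hank q n s) (-1 : Matrix (NI q n) (NI q n) ℂ) * kvq q n
      = fromCols ((1 - (α:ℂ) • bshift q n) * hank q n s * vq q n) (- vq q n) := by
    rw [RT_inv, kvq, fromCols_mul_fromBlocks]
    simp
  have hU : ∀ ζ, Utilde q n α s G ζ = 1 + (ζ - (α : ℂ)) •
      ((fromCols ((RT q n (α : ℂ))⁻¹ * hank q n s) (-1 : Matrix (NI q n) (NI q n) ℂ) * kvq q n)ᴴ * RTs q n ζ * G *
       (RT q n (α : ℂ) * fromCols (1 : Matrix (NI q n) (NI q n) ℂ) ((RT q n (α : ℂ))⁻¹ * hank q n s) * kvq q n)) := by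
    intro ζ
    rw [Utilde, Matrix.conjTranspose_mul]
    simp only [Matrix.mul_assoc]
  have hCJ : fromCols (RT q n α * vq q n) (hank q n s * vq q n) * Jmat q =
      Complex.I • (RT q n α * fromCols ((1 - (α:ℂ) • bshift q n) * hank q n s * vq q n) (- vq q n)) := by
    rw [Jmat, fromCols_mul_fromBlocks, mul_fromCols, Matrix.mul_assoc (1 - (α:ℂ) • bshift q n), ← Matrix.mul_assoc (RT q n α) (1 - (α:ℂ) • bshift q n), hRT,
      Matrix.one_mul]
    ext i (j | j) <;> simp
  have hCJC : fromCols (RT q n α * vq q n) (hank q n s * vq q n) * Jmat q *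
      (fromCols (RT q n α * vq q n) (hank q n s * vq q n))ᴴ =
      (-Complex.I) • (hank q n (sShift α s) * (bshift q n)ᴴ * (RT q n α)ᴴ
        - RT q n α * bshift q n * hank q n (sShift α s)) := by
    have h1 : RT q n α * bshift q n * hank q n (sShift α s) =
        hank q n s - RT q n α * vq q n * (vq q n)ᴴ * hank q n s := by
      rw [Matrix.mul_assoc, hsh, Matrix.mul_sub, ← Matrix.mul_assoc, hRT, Matrix.one_mul]
      simp only [Matrix.mul_assoc]
    have h2 := congrArg conjTranspose h1
    simp only [Matrix.conjTranspose_mul, Matrix.conjTranspose_sub, hH, hHa,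
      Matrix.conjTranspose_conjTranspose] at h2
    rw [Matrix.mul_assoc (hank q n (sShift α s)), h2, h1, Jmat, fromCols_mul_fromBlocks,
      conjTranspose_fromCols_eq_fromRows_conjTranspose, fromCols_mul_fromRows]
    simp only [Matrix.mul_zero, zero_add, add_zero, Matrix.mul_smul, Matrix.smul_mul, Matrix.mul_one,
      Matrix.conjTranspose_mul, hH, Matrix.mul_assoc]
    module
  have hJ : (Jmat q)ᴴ = Jmat q := by
    rw [Jmat, fromBlocks_conjTranspose]; simp
  have hUw : (Utilde q n α s G w)ᴴ = 1 + (conj w - (α : ℂ)) •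
      ((fromCols (RT q n α * vq q n) (hank q n s * vq q n))ᴴ * G * (RTs q n w)ᴴ *
        (fromCols ((1 - (α:ℂ) • bshift q n) * hank q n s * vq q n) (- vq q n))) := by
    rw [hU, hCm, hBm]
    simp only [Matrix.conjTranspose_add, Matrix.conjTranspose_smul, Matrix.conjTranspose_mul,
      Matrix.conjTranspose_one, Matrix.conjTranspose_conjTranspose, hG, Matrix.mul_assoc]
    simp
  rw [hUw, hU, hCm, hBm]
  rw [abs_alg _ _ _ (RTs q n z) (RT q n α) _ (bshift q n) G (hank q n (sShift α s)) _ _ hJ hCJ hCJC hHa hG hR]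
  · rw [← hBm, Matrix.conjTranspose_mul]
    simp only [Matrix.mul_assoc, sub_sub_sub_cancel_right]
  · rw [RTs_eq, Matrix.conjTranspose_conjTranspose]; exact hres1
  · rw [RTs_eq]
    simpa [Matrix.conjTranspose_mul, Matrix.mul_assoc] using hres2

def rowS {q : ℕ} (a : ℕ → Matrix (Fin q) (Fin q) ℂ) (N : ℕ) (x : ℕ → Fin q → ℂ) (i : ℕ) :
    Fin q → ℂ := ∑ k ∈ Finset.range (N + 1), a (i + k) *ᵥ x k

def Zm (q : ℕ) (a : ℕ → Matrix (Fin q) (Fin q) ℂ) (n : ℕ) : Matrix (Fin q) (NI q n) ℂ :=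
  Matrix.of fun (c : Fin q) (j : Fin (n + 1) × Fin q) => a ((n + 1) + j.1.val) c j.2

def Ym (q : ℕ) (a : ℕ → Matrix (Fin q) (Fin q) ℂ) (n : ℕ) : Matrix (NI q n) (Fin q) ℂ :=
  Matrix.of fun (j : Fin (n + 1) × Fin q) (b : Fin q) => a ((n + 1) + j.1.val) j.2 b

theorem LS_succ (q : ℕ) (a : ℕ → Matrix (Fin q) (Fin q) ℂ) (n : ℕ) :
    LS q a (n + 1) = a (2 * (n + 1)) - Zm q a n * mp (hank q n a) * Ym q a n := by
  rw [LS]; rfl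

theorem sum_blocks {q : ℕ} (N : ℕ) (f : ℕ → Matrix (Fin q) (Fin q) ℂ) (x : ℕ → Fin q → ℂ) (c : Fin q) :
    ∑ p : NI q N, f p.1.val c p.2 * x p.1.val p.2 =
      (∑ k ∈ Finset.range (N + 1), f k *ᵥ x k) c := by
  rw [Fintype.sum_prod_type, Finset.sum_apply,
    Finset.sum_range (fun k => (f k *ᵥ x k) c)]
  rfl

theorem hank_mulVec {q : ℕ} (a : ℕ → Matrix (Fin q) (Fin q) ℂ) (N : ℕ) (x : ℕ → Fin q → ℂ) (p : NI q N) :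
    (hank q N a *ᵥ fun p => x p.1.val p.2) p = rowS a N x p.1.val p.2 :=
  sum_blocks N (fun k => a (p.1.val + k)) x p.2

theorem Zm_mulVec {q : ℕ} (a : ℕ → Matrix (Fin q) (Fin q) ℂ) (N : ℕ) (x : ℕ → Fin q → ℂ) :
    (Zm q a N *ᵥ fun p => x p.1.val p.2) = rowS a N x (N + 1) := by
  ext c
  exact sum_blocks N (fun k => a (N + 1 + k)) x c

theorem Ym_mulVec {q : ℕ} (a : ℕ → Matrix (Fin q) (Fin q) ℂ) (N : ℕ) (u : Fin q → ℂ) (p : NI q N) :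
    (Ym q a N *ᵥ u) p = (a (p.1.val + (N + 1)) *ᵥ u) p.2 := by
  rw [add_comm]; rfl

theorem psd_row {q : ℕ} (a : ℕ → Matrix (Fin q) (Fin q) ℂ) (N : ℕ) (h : (hank q N a).PosSemidef)
    (x : ℕ → Fin q → ℂ) (hx : ∀ i ≤ N, x i = 0 ∨ rowS a N x i = 0) :
    ∀ i ≤ N, rowS a N x i = 0 := by
  have h1 := (h.dotProduct_mulVec_zero_iff (fun p => x p.1.val p.2)).mp (by
    apply Finset.sum_eq_zero
    intro p _
    rw [hank_mulVec]
    rcases hx p.1.val (by omega) with h | h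
    · simp [h]
    · simp [h])
  intro i hi
  ext c
  have := congrFun h1 (⟨i, by omega⟩, c)
  rw [hank_mulVec] at this
  exact this

theorem rowS_ext {q : ℕ} (a : ℕ → Matrix (Fin q) (Fin q) ℂ) (m N : ℕ) (hm : m ≤ N)
    (x : ℕ → Fin q → ℂ) (hx : ∀ k, m < k → x k = 0) (i : ℕ) : rowS a N x i = rowS a m x i := by
  symm
  apply Finset.sum_subset
  · intro k; simp; omega
  · intro k _ hk
    rw [hx k (by simp at hk; omega), Matrix.mulVec_zero]

theorem hank_sub {q : ℕ} (a : ℕ → Matrix (Fin q) (Fin q) ℂ) (m N : ℕ) (hm : m ≤ N)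
    (h : (hank q N a).PosSemidef) : (hank q m a).PosSemidef :=
  h.submatrix (fun p : NI q m => ((Fin.castLE (by omega) p.1 : Fin (N + 1)), p.2))

theorem seq_herm {q : ℕ} (a : ℕ → Matrix (Fin q) (Fin q) ℂ) (N : ℕ)
    (h : (hank q N a).PosSemidef) (i : ℕ) (hi : i ≤ 2 * N) : (a i)ᴴ = a i := by
  ext c d
  have := congrFun (congrFun h.1 (⟨min i N, by omega⟩, c)) (⟨i - min i N, by omega⟩, d)
  simp only [hank, conjTranspose_apply, of_apply] at this
  rw [show i - min i N + min i N = i by omega, show min i N + (i - min i N) = i by omega] at this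
  exact this

theorem hank_herm {q : ℕ} (a : ℕ → Matrix (Fin q) (Fin q) ℂ) (N : ℕ)
    (h : ∀ i ≤ 2 * N, (a i)ᴴ = a i) : (hank q N a)ᴴ = hank q N a := by
  ext p r
  simp only [hank, conjTranspose_apply, of_apply]
  rw [add_comm, ← conjTranspose_apply, h _ (by omega)]

theorem mp_spec {ι : Type*} [Fintype ι] [DecidableEq ι] (A : Matrix ι ι ℂ) (hA : A.IsHermitian) :
    A * mp A * A = A ∧ mp A * A * mp A = mp A ∧ (A * mp A)ᴴ = A * mp A ∧ (mp A * A)ᴴ = mp A * A := by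
  have h : ∃ X : Matrix ι ι ℂ,
      A * X * A = A ∧ X * A * X = X ∧ (A * X)ᴴ = A * X ∧ (X * A)ᴴ = X * A := by
    have hs := hA.spectral_theorem
    set U : Matrix ι ι ℂ := (hA.eigenvectorUnitary : Matrix ι ι ℂ) with hU
    set d : ι → ℂ := RCLike.ofReal ∘ hA.eigenvalues with hd
    have hUU : Uᴴ * U = 1 := by
      have := (Matrix.mem_unitaryGroup_iff').mp hA.eigenvectorUnitary.2
      exact this
    have hA' : A = U * diagonal d * Uᴴ := by
      rw [hs]; rfl
    have hds : star d = d := by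
      ext i; simp [hd]
    have hc : ∀ x y : ι → ℂ, (U * diagonal x * Uᴴ) * (U * diagonal y * Uᴴ) =
        U * diagonal (fun i => x i * y i) * Uᴴ := by
      intro x y
      rw [← diagonal_mul_diagonal]
      calc _ = U * diagonal x * (Uᴴ * U) * diagonal y * Uᴴ := by simp only [mul_assoc]
        _ = _ := by rw [hUU, mul_one]; simp only [mul_assoc]
    have hh : ∀ x : ι → ℂ, (∀ i, star (x i) = x i) → (U * diagonal x * Uᴴ)ᴴ = U * diagonal x * Uᴴ := by
      intro x hx
      have : star x = x := funext hx
      simp [Matrix.conjTranspose_mul, this, mul_assoc]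
    have hdi : ∀ i, star (d i) = d i := fun i => congrFun hds i
    refine ⟨U * diagonal (fun i => (d i)⁻¹) * Uᴴ, ?_, ?_, ?_, ?_⟩
    · rw [hA', hc, hc]; congr; ext i; exact mul_inv_mul_cancel _
    · rw [hA', hc, hc]; congr; ext i
      by_cases hi : d i = 0
      · simp [hi]
      · field_simp
    · rw [hA', hc]; apply hh; intro i; rw [star_mul', star_inv₀, hdi]
    · rw [hA', hc]; apply hh; intro i; rw [star_mul', star_inv₀, hdi]
  rw [mp, dif_pos h]
  exact h.choose_spec

theorem toSeq {q : ℕ} (N : ℕ) (w : NI q N → ℂ) : ∃ x : ℕ → Fin q → ℂ,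
    (w = fun p => x p.1.val p.2) ∧ ∀ k, N < k → x k = 0 := by
  refine ⟨fun k => if h : k < N + 1 then fun c => w (⟨k, h⟩, c) else 0, ?_, ?_⟩
  · ext p; simp only [p.1.isLt, dif_pos]
  · intro k hk; simp; omega

theorem Zker {q : ℕ} (a : ℕ → Matrix (Fin q) (Fin q) ℂ) (m : ℕ) (h : (hank q (m + 1) a).PosSemidef)
    (w : NI q m → ℂ) (hw : hank q m a *ᵥ w = 0) : Zm q a m *ᵥ w = 0 := by
  obtain ⟨x, rfl, hx⟩ := toSeq m w
  rw [Zm_mulVec, ← rowS_ext a m (m + 1) (by omega) x hx]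
  apply psd_row a (m + 1) h _ _ _ le_rfl
  intro i hi
  rcases Nat.lt_or_ge m i with h' | h'
  · left; exact hx i h'
  · right
    rw [rowS_ext a m (m + 1) (by omega) x hx]
    ext c
    have := congrFun hw (⟨i, by omega⟩, c)
    rw [hank_mulVec] at this
    exact this

theorem Zker_mat {q : ℕ} (a : ℕ → Matrix (Fin q) (Fin q) ℂ) (m : ℕ) (h : (hank q (m + 1) a).PosSemidef)
    (M : Matrix (NI q m) (NI q m) ℂ) (hM : hank q m a * M = 0) : Zm q a m * M = 0 := by
  apply Matrix.ext_of_mulVec_single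
  intro j
  rw [← Matrix.mulVec_mulVec, Zker a m h, Matrix.zero_mulVec]
  rw [Matrix.mulVec_mulVec, hM, Matrix.zero_mulVec]

theorem Y_adj {q : ℕ} (a : ℕ → Matrix (Fin q) (Fin q) ℂ) (m : ℕ) (h : (hank q (m + 1) a).PosSemidef) :
    (Zm q a m)ᴴ = Ym q a m := by
  ext p c
  simp only [Zm, Ym, conjTranspose_apply, of_apply]
  rw [← conjTranspose_apply, seq_herm a (m + 1) h _ (by omega)]

theorem Z_facts {q : ℕ} (a : ℕ → Matrix (Fin q) (Fin q) ℂ) (m : ℕ) (h : (hank q (m + 1) a).PosSemidef) :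
    Zm q a m * (mp (hank q m a) * hank q m a) = Zm q a m ∧
    Zm q a m * (hank q m a * mp (hank q m a)) = Zm q a m ∧
    hank q m a * mp (hank q m a) * Ym q a m = Ym q a m := by
  have hH := (hank_sub a m (m + 1) (by omega) h).1
  obtain ⟨h1, h2, h3, h4⟩ := mp_spec _ hH
  have f1 : Zm q a m * (mp (hank q m a) * hank q m a) = Zm q a m := by
    have := Zker_mat a m h (1 - mp (hank q m a) * hank q m a) (by
      rw [mul_sub, mul_one, ← mul_assoc, h1, sub_self])
    rw [Matrix.mul_sub, Matrix.mul_one, sub_eq_zero] at this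
    exact this.symm
  have f2 : Zm q a m * (hank q m a * mp (hank q m a)) = Zm q a m := by
    have := Zker_mat a m h (1 - hank q m a * mp (hank q m a)) (by
      have := congrArg conjTranspose h1
      rw [Matrix.conjTranspose_mul, h3, hH.eq] at this
      rw [mul_sub, mul_one, this, sub_self])
    rw [Matrix.mul_sub, Matrix.mul_one, sub_eq_zero] at this
    exact this.symm
  refine ⟨f1, f2, ?_⟩
  have := congrArg conjTranspose f2
  rwa [Matrix.conjTranspose_mul, h3, Y_adj a m h] at this

theorem LS_herm {q : ℕ} (a : ℕ → Matrix (Fin q) (Fin q) ℂ) (j : ℕ) (h : (hank q j a).PosSemidef) :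
    (LS q a j)ᴴ = LS q a j := by
  cases j with
  | zero => rw [LS]; exact seq_herm a 0 h 0 (by omega)
  | succ m =>
    have hH := (hank_sub a m (m + 1) (by omega) h).1
    obtain ⟨h1, h2, h3, h4⟩ := mp_spec _ hH
    obtain ⟨f1, f2, f3⟩ := Z_facts a m h
    have hZ : (Ym q a m)ᴴ = Zm q a m := by rw [← Y_adj a m h, conjTranspose_conjTranspose]
    have h5 : (mp (hank q m a))ᴴ * hank q m a = hank q m a * mp (hank q m a) := by
      rw [← h3, Matrix.conjTranspose_mul, hH.eq]
    rw [LS_succ, Matrix.conjTranspose_sub, seq_herm a (m + 1) h _ (by omega)]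
    congr 1
    rw [Matrix.conjTranspose_mul, Matrix.conjTranspose_mul, hZ, Y_adj a m h]
    calc Zm q a m * ((mp (hank q m a))ᴴ * Ym q a m)
        = Zm q a m * ((mp (hank q m a))ᴴ * (hank q m a * mp (hank q m a) * Ym q a m)) := by rw [f3]
      _ = Zm q a m * (((mp (hank q m a))ᴴ * hank q m a) * (mp (hank q m a) * Ym q a m)) := by
        simp only [Matrix.mul_assoc]
      _ = (Zm q a m * (hank q m a * mp (hank q m a))) * (mp (hank q m a) * Ym q a m) := by
        rw [h5]; simp only [Matrix.mul_assoc]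
      _ = _ := by rw [f2, Matrix.mul_assoc]

theorem rowS_succ {q : ℕ} (a : ℕ → Matrix (Fin q) (Fin q) ℂ) (m : ℕ) (x : ℕ → Fin q → ℂ) (i : ℕ) :
    rowS a (m + 1) x i = rowS a m x i + a (i + (m + 1)) *ᵥ x (m + 1) :=
  Finset.sum_range_succ _ _

theorem LS_row {q : ℕ} (a : ℕ → Matrix (Fin q) (Fin q) ℂ) (j : ℕ) (h : (hank q j a).PosSemidef)
    (x : ℕ → Fin q → ℂ) (hx : ∀ i < j, rowS a j x i = 0) :
    rowS a j x j = LS q a j *ᵥ x j := by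
  cases j with
  | zero => simp [rowS, LS]
  | succ m =>
    obtain ⟨f1, f2, f3⟩ := Z_facts a m h
    have e : Ym q a m *ᵥ x (m + 1) = - (hank q m a *ᵥ fun p => x p.1.val p.2) := by
      ext p
      have := hx p.1.val (by omega)
      rw [rowS_succ] at this
      rw [Ym_mulVec, Pi.neg_apply, hank_mulVec, eq_neg_of_add_eq_zero_right this]
      rfl
    rw [LS_succ, Matrix.sub_mulVec, ← Matrix.mulVec_mulVec, e, Matrix.mulVec_neg, Matrix.mulVec_mulVec,
      Matrix.mul_assoc, f1, rowS_succ, Zm_mulVec, sub_neg_eq_add, add_comm, two_mul]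

theorem LS_ex {q : ℕ} (a : ℕ → Matrix (Fin q) (Fin q) ℂ) (j : ℕ) (h : (hank q j a).PosSemidef)
    (u : Fin q → ℂ) : ∃ x : ℕ → Fin q → ℂ, x j = u ∧ (∀ k, j < k → x k = 0) ∧
      ∀ i < j, rowS a j x i = 0 := by
  cases j with
  | zero => exact ⟨fun k => if k = 0 then u else 0, by simp, fun k hk => by simp; omega, by simp⟩
  | succ m =>
    obtain ⟨f1, f2, f3⟩ := Z_facts a m h
    obtain ⟨y, hy, hy0⟩ := toSeq m (-(mp (hank q m a) *ᵥ (Ym q a m *ᵥ u)))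
    refine ⟨fun k => if k = m + 1 then u else y k, by simp, ?_, ?_⟩
    · intro k hk
      simp only
      rw [if_neg (by omega), hy0 k (by omega)]
    · intro i hi
      rw [rowS_succ]
      have e : rowS a m (fun k => if k = m + 1 then u else y k) i = rowS a m y i := by
        apply Finset.sum_congr rfl
        intro k hk
        have hk' : k ≠ m + 1 := by simp at hk; omega
        simp only [if_neg hk']
      rw [e]
      ext c
      have h1 := hank_mulVec a m y (⟨i, by omega⟩, c)
      rw [← hy, Matrix.mulVec_neg, Matrix.mulVec_mulVec, Matrix.mulVec_mulVec, f3, Pi.neg_apply,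
        Ym_mulVec] at h1
      simp only [Pi.add_apply, if_true]
      rw [← h1]
      simp

theorem LS_nest {q : ℕ} (α : ℝ) (n : ℕ) (t : ℕ → Matrix (Fin q) (Fin q) ℂ)
    (h1 : (hank q (n + 1) t).PosSemidef) (h2 : (hank q n (sShift α t)).PosSemidef)
    (j : ℕ) (hj : j + 1 ≤ n) (u : Fin q → ℂ) (hu : LS q (sShift α t) j *ᵥ u = 0) :
    LS q (sShift α t) (j + 1) *ᵥ u = 0 := by
  have pj := hank_sub (sShift α t) j n (by omega) h2
  have pj1 := hank_sub (sShift α t) (j + 1) n (by omega) h2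
  obtain ⟨x, hxu, hx0, hx⟩ := LS_ex (sShift α t) j pj u
  have hxj := LS_row _ j pj x hx
  rw [hxu, hu] at hxj
  have r1 : ∀ i ≤ j + 1, rowS (sShift α t) j x i = 0 := by
    intro i hi
    rw [← rowS_ext _ j (j + 1) (by omega) x hx0]
    apply psd_row _ _ pj1 _ _ _ hi
    intro k hk
    rw [rowS_ext _ j (j + 1) (by omega) x hx0]
    rcases Nat.lt_trichotomy k j with h | h | h
    · right; exact hx k h
    · right; rw [h]; exact hxj
    · left; exact hx0 k h
  let y : ℕ → Fin q → ℂ := fun k => (-(α : ℂ)) • x k + (match k with | 0 => 0 | k + 1 => x k)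
  have hy : ∀ i, rowS t (n + 1) y i = rowS (sShift α t) j x i := by
    intro i
    rw [← rowS_ext _ j (n + 1) (by omega) x hx0]
    simp only [rowS, y, sShift, Matrix.mulVec_add, Matrix.add_mulVec, Finset.sum_add_distrib,
      Matrix.mulVec_smul, Matrix.smul_mulVec]
    congr 1
    rw [Finset.sum_range_succ', Finset.sum_range_succ _ (n + 1), hx0 (n + 1) (by omega)]
    simp [add_assoc]
  have r2 : ∀ i ≤ n + 1, rowS (sShift α t) j x i = 0 := by
    intro i hi
    rw [← hy]
    apply psd_row _ _ h1 _ _ _ hi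
    intro k hk
    rw [hy]
    rcases Nat.lt_or_ge (j + 1) k with h | h
    · left
      obtain ⟨k, rfl⟩ : ∃ k', k = k' + 1 := ⟨k - 1, by omega⟩
      simp only [y]
      rw [hx0 _ (by omega), hx0 _ (by omega)]; simp
    · right; exact r1 k h
  let x' : ℕ → Fin q → ℂ := fun k => match k with | 0 => 0 | k + 1 => x k
  have hx' : ∀ i, rowS (sShift α t) (j + 1) x' i = rowS (sShift α t) j x (i + 1) := by
    intro i
    simp only [rowS, x']
    rw [Finset.sum_range_succ']
    simp only [Matrix.mulVec_zero, add_zero]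
    apply Finset.sum_congr rfl
    intro k _
    rw [add_assoc, add_comm 1 k]
  have := LS_row _ (j + 1) pj1 x' (fun i hi => by rw [hx', r2 _ (by omega)])
  rw [hx', r2 _ (by omega)] at this
  rw [← hxu]
  exact this.symm

theorem hank_congr {q : ℕ} (a b : ℕ → Matrix (Fin q) (Fin q) ℂ) (n : ℕ) (h : ∀ i ≤ 2 * n, a i = b i) :
    hank q n a = hank q n b := by
  ext p r
  simp only [hank, of_apply]
  rw [h _ (by omega)]

theorem LS_congr {q : ℕ} (a b : ℕ → Matrix (Fin q) (Fin q) ℂ) (n : ℕ) (h : ∀ i ≤ 2 * n, a i = b i) :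
    LS q a n = LS q b n := by
  cases n with
  | zero => simp only [LS]; exact h 0 (by omega)
  | succ m =>
    rw [LS_succ, LS_succ, h _ le_rfl, hank_congr a b m (fun i hi => h i (by omega))]
    have e1 : Zm q a m = Zm q b m := by
      ext c p; simp only [Zm, of_apply]; rw [h _ (by omega)]
    have e2 : Ym q a m = Ym q b m := by
      ext c p; simp only [Ym, of_apply]; rw [h _ (by omega)]
    rw [e1, e2]

theorem Ldiag_mulVec {q : ℕ} (a : ℕ → Matrix (Fin q) (Fin q) ℂ) (n : ℕ) (x : NI q n → ℂ) (i : Fin (n + 1))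
    (c : Fin q) : (Ldiag q n a *ᵥ x) (i, c) = (LS q a i.val *ᵥ fun d => x (i, d)) c := by
  simp only [Ldiag, Matrix.mulVec, dotProduct, of_apply, Fintype.sum_prod_type]
  rw [Finset.sum_eq_single i]
  · simp
  · intro k _ hk
    simp [Ne.symm hk]
  · simp
/-- Lemma (ML28-2): the fundamental `J̃_q`-identity for the matrix polynomial `Ũ_{n,α}`. -/
theorem J_identity_for_U_tilde
    (q : ℕ) (hq : 1 ≤ q) (α : ℝ) (n : ℕ) (s : ℕ → Matrix (Fin q) (Fin q) ℂ)
    (hK : ∃ t : ℕ → Matrix (Fin q) (Fin q) ℂ,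
      (∀ j ≤ 2 * n + 1, t j = s j) ∧
        (hank q (n + 1) t).PosSemidef ∧ (hank q n (sShift α t)).PosSemidef)
    (Gα : Matrix (Fin (n + 1) × Fin q) (Fin (n + 1) × Fin q) ℂ)
    (hGα : IsRGI (hank q n (sShift α s)) Gα (Dsub q n (sShift α s))) :
    ∀ z w : ℂ,
      Jmat q - Utilde q n α s Gα z * Jmat q * (Utilde q n α s Gα w)ᴴ =
        ((-Complex.I) * (z - conj w)) •
          ((kvq q n)ᴴ *
            (Matrix.fromCols ((RT q n (α : ℂ))⁻¹ * hank q n s)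
              (-1 : Matrix (Fin (n + 1) × Fin q) (Fin (n + 1) × Fin q) ℂ))ᴴ * RTs q n z *
            Gα * (RTs q n w)ᴴ *
            Matrix.fromCols ((RT q n (α : ℂ))⁻¹ * hank q n s)
              (-1 : Matrix (Fin (n + 1) × Fin q) (Fin (n + 1) × Fin q) ℂ) *
            kvq q n) := by
  intro z w
  obtain ⟨t, hts, ht1, ht2⟩ := hK
  have ha : ∀ i ≤ 2 * n, sShift α s i = sShift α t i := by
    intro i hi
    simp only [sShift]
    rw [hts i (by omega), hts (i + 1) (by omega)]
  have hHa : (hank q n (sShift α s))ᴴ = hank q n (sShift α s) := by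
    rw [hank_congr _ _ n ha]; exact ht2.1
  have hH : (hank q n s)ᴴ = hank q n s := by
    apply hank_herm
    intro i hi
    rw [← hts i (by omega)]
    exact seq_herm t (n + 1) ht1 i (by omega)
  have hG := RGI_herm _ _ _ hGα hHa
  have hLS : ∀ j ≤ n, LS q (sShift α s) j = LS q (sShift α t) j := fun j hj =>
    LS_congr _ _ j (fun i hi => ha i (by omega))
  have hL : (Ldiag q n (sShift α s))ᴴ = Ldiag q n (sShift α s) := by
    ext ⟨i, c⟩ ⟨j, d⟩
    simp only [Ldiag, conjTranspose_apply, of_apply]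
    by_cases hij : i = j
    · subst hij
      simp only [if_true]
      rw [← conjTranspose_apply, hLS _ (by omega),
        LS_herm _ _ (hank_sub (sShift α t) i.val n (by omega) ht2)]
    · rw [if_neg hij, if_neg (Ne.symm hij), star_zero]
  have hker := RGI_ker _ _ _ hGα hL
  refine main_alg q n α s Gα hH hHa hG (G_RT q n α _ _ hGα.2.1 ?_) z w
  intro x hx
  rw [hker] at hx ⊢
  ext ⟨i, c⟩
  rw [Ldiag_mulVec]
  refine Fin.cases ?_ (fun i => ?_) i
  · simp only [bshift_mulVec_zero]
    exact congrFun (Matrix.mulVec_zero _) c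
  · simp only [bshift_mulVec_succ]
    have h0 : LS q (sShift α t) i.val *ᵥ (fun d => x (i.castSucc, d)) = 0 := by
      rw [← hLS _ (by omega)]
      ext d
      have := congrFun hx (i.castSucc, d)
      rw [Ldiag_mulVec] at this
      exact this
    have h1 := LS_nest α n t ht1 ht2 i.val (by omega) _ h0
    rw [hLS _ (by omega), Fin.val_succ, h1]
    rfl
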